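/- arXiv:1907.05142 — 6 statements merged into one kernel-verified Lean document; each statement's English description precedes it below -/
import Mathlib

section
/- For all real numbers λ > 0, β ∈ (0,1), and z ≤ λ, the improper integral ∫₀^∞ (e^{z·x} − 1)·x^{−1−β}·e^{−λ·x} dx converges absolutely and equals Γ(−β)·((λ−z)^β − λ^β). -/
open MeasureTheory Set Filter Topology

lemma one_sub_exp_neg_mul_nonneg {a x : ℝ} (ha : 0 ≤ a) (hx : 0 ≤ x) :
    0 ≤ 1 - Real.exp (-(a * x)) := by
  have := Real.exp_le_one_iff.2 (neg_nonpos.2 (mul_nonneg ha hx))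
  linarith

lemma one_sub_exp_neg_le (y : ℝ) : 1 - Real.exp (-y) ≤ y := by
  have := Real.add_one_le_exp (-y)
  linarith

lemma integrableOn_one_sub_exp_mul_rpow {a beta : ℝ} (ha : 0 ≤ a) (h0 : 0 < beta)
    (h1 : beta < 1) :
    IntegrableOn (fun x : ℝ => (1 - Real.exp (-(a * x))) * x ^ (-1 - beta)) (Ioi 0) := by
  have hmeas : Measurable fun x : ℝ => (1 - Real.exp (-(a * x))) * x ^ (-1 - beta) := by
    fun_prop
  rw [← Ioc_union_Ioi_eq_Ioi zero_le_one]
  refine IntegrableOn.union ?_ ?_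
  · have hdom : IntegrableOn (fun x : ℝ => a * x ^ (-beta)) (Ioc 0 1) := by
      refine Integrable.const_mul ?_ a
      exact (intervalIntegrable_iff_integrableOn_Ioc_of_le zero_le_one).1
        (intervalIntegral.intervalIntegrable_rpow' (by linarith))
    refine Integrable.mono' hdom hmeas.aestronglyMeasurable ?_
    filter_upwards [ae_restrict_mem measurableSet_Ioc] with x hx
    have hpow := Real.rpow_nonneg hx.1.le (-1 - beta)
    rw [Real.norm_of_nonneg (mul_nonneg (one_sub_exp_neg_mul_nonneg ha hx.1.le) hpow)]
    calc _ ≤ a * x * x ^ (-1 - beta) := by gcongr; exact one_sub_exp_neg_le _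
      _ = a * x ^ (-beta) := by
        rw [mul_assoc, ← Real.rpow_one_add' hx.1.le (by linarith)]
        ring_nf
  · refine Integrable.mono' (integrableOn_Ioi_rpow_of_lt (a := -1 - beta) (by linarith)
      zero_lt_one) hmeas.aestronglyMeasurable ?_
    filter_upwards [ae_restrict_mem measurableSet_Ioi] with x hx
    have hx0 : (0 : ℝ) ≤ x := zero_le_one.trans (le_of_lt hx)
    have hpow := Real.rpow_nonneg hx0 (-1 - beta)
    rw [Real.norm_of_nonneg (mul_nonneg (one_sub_exp_neg_mul_nonneg ha hx0) hpow)]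
    exact mul_le_of_le_one_left hpow (by linarith [Real.exp_pos (-(a * x))])

lemma tendsto_one_sub_exp_mul_rpow_zero {a beta : ℝ} (ha : 0 ≤ a) (h1 : beta < 1) :
    Tendsto (fun x : ℝ => (1 - Real.exp (-(a * x))) * x ^ (-beta)) (𝓝[>] 0) (𝓝 0) := by
  have hlim : Tendsto (fun x : ℝ => a * x ^ (1 - beta)) (𝓝[>] 0) (𝓝 0) := by
    have hc : Continuous fun x : ℝ => a * x ^ (1 - beta) :=
      (Real.continuous_rpow_const (by linarith)).const_mul a
    have := hc.tendsto 0
    rw [Real.zero_rpow (by linarith), mul_zero] at this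
    exact this.mono_left nhdsWithin_le_nhds
  refine squeeze_zero' ?_ ?_ hlim <;> filter_upwards [self_mem_nhdsWithin] with x (hx : 0 < x)
  · exact mul_nonneg (one_sub_exp_neg_mul_nonneg ha hx.le) (Real.rpow_nonneg hx.le _)
  · calc _ ≤ a * x * x ^ (-beta) := by gcongr; exact one_sub_exp_neg_le _
      _ = a * x ^ (1 - beta) := by
        rw [mul_assoc, ← Real.rpow_one_add' hx.le (by linarith)]
        ring_nf

lemma tendsto_one_sub_exp_mul_rpow_atTop {a beta : ℝ} (ha : 0 ≤ a) (h0 : 0 < beta) :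
    Tendsto (fun x : ℝ => (1 - Real.exp (-(a * x))) * x ^ (-beta)) atTop (𝓝 0) := by
  refine squeeze_zero' ?_ ?_ (tendsto_rpow_neg_atTop h0) <;>
    filter_upwards [eventually_ge_atTop (0 : ℝ)] with x hx
  · exact mul_nonneg (one_sub_exp_neg_mul_nonneg ha hx) (Real.rpow_nonneg hx _)
  · exact mul_le_of_le_one_left (Real.rpow_nonneg hx _) (by linarith [Real.exp_pos (-(a * x))])

lemma integral_one_sub_exp_mul_rpow {a beta : ℝ} (ha : 0 ≤ a) (h0 : 0 < beta)
    (h1 : beta < 1) :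
    ∫ x in Ioi (0 : ℝ), (1 - Real.exp (-(a * x))) * x ^ (-1 - beta) =
      -(Real.Gamma (-beta) * a ^ beta) := by
  rcases ha.eq_or_lt with rfl | ha'
  · simp [Real.zero_rpow h0.ne']
  have hrpow : IntegrableOn (fun x : ℝ => x ^ (-beta) * Real.exp (-(a * x))) (Ioi 0) := by
    simpa using integrableOn_rpow_mul_exp_neg_mul_rpow (s := -beta) (p := 1) (by linarith)
      zero_lt_one ha'
  have hparts := integral_Ioi_mul_deriv_eq_deriv_mul (a := (0 : ℝ))
    (u := fun x : ℝ => 1 - Real.exp (-(a * x))) (v := fun x : ℝ => x ^ (-beta) / -beta)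
    (u' := fun x : ℝ => a * Real.exp (-(a * x))) (v' := fun x : ℝ => x ^ (-1 - beta))
    (a' := 0) (b' := 0) ?_ ?_ (integrableOn_one_sub_exp_mul_rpow ha h0 h1) ?_ ?_ ?_
  · rw [hparts]
    have hgamma := Real.integral_rpow_mul_exp_neg_mul_Ioi (a := 1 - beta) (r := a)
      (by linarith) ha'
    have hstep : Real.Gamma (1 - beta) = -beta * Real.Gamma (-beta) := by
      rw [← Real.Gamma_add_one (by linarith)]
      ring_nf
    have hfun : ∀ x : ℝ, a * Real.exp (-(a * x)) * (x ^ (-beta) / -beta) =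
        (a / -beta) * (x ^ (1 - beta - 1) * Real.exp (-(a * x))) := fun x => by
      rw [show 1 - beta - 1 = -beta by ring]
      ring
    simp_rw [hfun]
    rw [integral_const_mul, hgamma, hstep, one_div, Real.inv_rpow ha, Real.rpow_sub ha',
      Real.rpow_one]
    field_simp
    ring
  · intro x _
    simpa [mul_comm] using (((hasDerivAt_id' x).const_mul a).fun_neg.exp).const_sub 1
  · intro x hx
    have h := (Real.hasDerivAt_rpow_const (p := -beta) (Or.inl (ne_of_gt hx))).div_const (-beta)
    convert h using 1
    rw [show -1 - beta = -beta - 1 by ring]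
    field_simp
  · refine (hrpow.const_mul (a / -beta)).congr (Eventually.of_forall fun x => ?_)
    simp only [Pi.mul_apply]
    ring
  · simpa [mul_div_assoc, Pi.mul_def] using
      (tendsto_one_sub_exp_mul_rpow_zero ha h1).div_const (-beta)
  · simpa [mul_div_assoc, Pi.mul_def] using
      (tendsto_one_sub_exp_mul_rpow_atTop ha h0).div_const (-beta)

/-- For all real numbers `λ > 0`, `β ∈ (0,1)` and `z ≤ λ`, the integral
`∫₀^∞ (e^{z·x} − 1)·x^{−1−β}·e^{−λ·x} dx` converges absolutely and equals
`Γ(−β)·((λ−z)^β − λ^β)`. -/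
theorem tempered_stable_cumulant_integral
    (lam beta z : ℝ) (hlam : 0 < lam) (hbeta : beta ∈ Set.Ioo (0 : ℝ) 1)
    (hz : z ≤ lam) :
    IntegrableOn
      (fun x : ℝ => (Real.exp (z * x) - 1) * x ^ (-1 - beta) * Real.exp (-lam * x))
      (Set.Ioi 0) ∧
    ∫ x in Set.Ioi (0 : ℝ),
        (Real.exp (z * x) - 1) * x ^ (-1 - beta) * Real.exp (-lam * x)
      = Real.Gamma (-beta) * ((lam - z) ^ beta - lam ^ beta) := by
  obtain ⟨h0, h1⟩ := hbeta
  have hz' : 0 ≤ lam - z := sub_nonneg.2 hz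
  have hfun : (fun x : ℝ => (Real.exp (z * x) - 1) * x ^ (-1 - beta) * Real.exp (-lam * x)) =
      fun x => (1 - Real.exp (-(lam * x))) * x ^ (-1 - beta) -
        (1 - Real.exp (-((lam - z) * x))) * x ^ (-1 - beta) := by
    funext x
    have h : Real.exp (-((lam - z) * x)) = Real.exp (z * x) * Real.exp (-lam * x) := by
      rw [← Real.exp_add]
      ring_nf
    rw [h, ← neg_mul]
    ring
  have hi := integrableOn_one_sub_exp_mul_rpow hlam.le h0 h1
  have hj := integrableOn_one_sub_exp_mul_rpow hz' h0 h1
  rw [hfun]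
  refine ⟨hi.sub hj, ?_⟩
  rw [integral_sub hi hj, integral_one_sub_exp_mul_rpow hlam.le h0 h1,
    integral_one_sub_exp_mul_rpow hz' h0 h1]
  ring
end

section
/- For all real numbers λ > 0, β ∈ (0,1), and t ∈ ℝ, the integral ∫₀^∞ (e^{i·t·x} − 1)·x^{−1−β}·e^{−λ·x} dx converges absolutely and equals Γ(−β)·((λ − i·t)^β − λ^β), where (λ − i·t)^β denotes the complex power taken with the principal branch of the complex logarithm. -/
open MeasureTheory Set

lemma norm_cexp_neg_mul_sub_le {c x : ℝ} {z w : ℂ} (hx : 0 ≤ x) (hz : c ≤ z.re) (hw : c ≤ w.re) :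
    ‖Complex.exp (-z * x) - Complex.exp (-w * x)‖ ≤ x * Real.exp (-c * x) * ‖z - w‖ := by
  refine (convex_halfSpace_re_ge c).norm_image_sub_le_of_norm_hasDerivWithin_le
    (f := fun u : ℂ => Complex.exp (-u * x)) (f' := fun u : ℂ => Complex.exp (-u * x) * (-1 * x))
    (fun u _ => (((hasDerivAt_id u).neg.mul_const (x : ℂ)).cexp).hasDerivWithinAt)
    (fun u hu => ?_) hw hz
  have hu : c ≤ u.re := hu
  rw [norm_mul, Complex.norm_exp, mul_comm]
  simp only [neg_mul, one_mul, norm_neg, Complex.norm_real, Real.norm_of_nonneg hx,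
    Complex.neg_re, Complex.re_mul_ofReal]
  gcongr

lemma aestronglyMeasurable_mul_rpow {f : ℝ → ℂ} (hf : Continuous f) (p : ℝ) (s : Set ℝ) :
    AEStronglyMeasurable (fun x : ℝ => f x * ((x ^ p : ℝ) : ℂ)) (volume.restrict s) :=
  (hf.measurable.mul (Complex.measurable_ofReal.comp (measurable_id.pow_const p))
    ).aestronglyMeasurable

lemma integrableOn_rpow_neg_mul_exp_neg_mul {b c : ℝ} (hb : b < 1) (hc : 0 < c) :
    IntegrableOn (fun x : ℝ => x ^ (-b) * Real.exp (-c * x)) (Ioi 0) := by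
  simpa using integrableOn_rpow_mul_exp_neg_mul_rpow (p := 1) (s := -b) (b := c)
    (by linarith) one_pos hc

lemma mul_rpow_neg_one_sub {x : ℝ} (hx : 0 < x) (b : ℝ) : x * x ^ (-1 - b) = x ^ (-b) := by
  rw [mul_comm, ← Real.rpow_add_one hx.ne']
  ring_nf

lemma integrableOn_cexp_sub_mul_rpow {b : ℝ} {z w : ℂ} (hb : b < 1) (hz : 0 < z.re)
    (hw : 0 < w.re) :
    IntegrableOn (fun x : ℝ => (Complex.exp (-z * x) - Complex.exp (-w * x)) *
      ((x ^ (-1 - b) : ℝ) : ℂ)) (Ioi 0) := by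
  refine Integrable.mono'
    ((integrableOn_rpow_neg_mul_exp_neg_mul hb (lt_min hz hw)).const_mul ‖z - w‖)
    (aestronglyMeasurable_mul_rpow (by fun_prop) _ _) ?_
  filter_upwards [ae_restrict_mem measurableSet_Ioi] with x (hx : 0 < x)
  rw [norm_mul, Complex.norm_real, Real.norm_of_nonneg (by positivity),
    ← mul_rpow_neg_one_sub hx]
  calc _ ≤ x * Real.exp (-min z.re w.re * x) * ‖z - w‖ * x ^ (-1 - b) := by
        gcongr
        exact norm_cexp_neg_mul_sub_le hx.le (min_le_left _ _) (min_le_right _ _)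
    _ = _ := by ring

lemma hasDerivAt_integral_cexp_sub_mul_rpow {b : ℝ} {z w : ℂ} (hb : b < 1) (hz : 0 < z.re)
    (hw : 0 < w.re) :
    HasDerivAt (fun u : ℂ => ∫ x in Ioi (0 : ℝ), (Complex.exp (-u * x) - Complex.exp (-w * x)) *
      ((x ^ (-1 - b) : ℝ) : ℂ))
      (∫ x in Ioi (0 : ℝ), Complex.exp (-z * x) * (-1 * x) * ((x ^ (-1 - b) : ℝ) : ℂ)) z := by
  refine (hasDerivAt_integral_of_dominated_loc_of_deriv_le
    (s := {u : ℂ | z.re / 2 < u.re})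
    (F := fun (u : ℂ) (x : ℝ) => (Complex.exp (-u * x) - Complex.exp (-w * x)) *
      ((x ^ (-1 - b) : ℝ) : ℂ))
    (F' := fun u x => Complex.exp (-u * x) * (-1 * x) * ((x ^ (-1 - b) : ℝ) : ℂ))
    (bound := fun x : ℝ => x ^ (-b) * Real.exp (-(z.re / 2) * x))
    ((isOpen_lt continuous_const Complex.continuous_re).mem_nhds (half_lt_self hz))
    (.of_forall fun u => aestronglyMeasurable_mul_rpow (by fun_prop) _ _)
    (integrableOn_cexp_sub_mul_rpow hb hz hw)
    (aestronglyMeasurable_mul_rpow (by fun_prop) _ _) ?_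
    (integrableOn_rpow_neg_mul_exp_neg_mul hb (half_pos hz)) ?_).2
  · filter_upwards [ae_restrict_mem measurableSet_Ioi] with x (hx : 0 < x) u (hu : z.re / 2 < u.re)
    rw [norm_mul, norm_mul, Complex.norm_real, Real.norm_of_nonneg (by positivity),
      Complex.norm_exp, mul_assoc, mul_comm, ← mul_rpow_neg_one_sub hx]
    simp only [neg_mul, one_mul, norm_neg, Complex.norm_real, Real.norm_of_nonneg hx.le,
      Complex.neg_re, Complex.re_mul_ofReal]
    gcongr
  · refine .of_forall fun x u _ => ?_
    exact ((((hasDerivAt_id u).neg.mul_const (x : ℂ)).cexp).sub_const _).mul_const _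

lemma integral_cexp_mul_rpow_of_pos {b r : ℝ} (hb : b < 1) (hb₀ : b ≠ 0) (hr : 0 < r) :
    ∫ x in Ioi (0 : ℝ), Complex.exp (-(r : ℂ) * x) * (-1 * x) * ((x ^ (-1 - b) : ℝ) : ℂ) =
      (Real.Gamma (-b) : ℂ) * ((b : ℂ) * (r : ℂ) ^ ((b : ℂ) - 1)) := by
  have hG : Real.Gamma (1 - b) = -b * Real.Gamma (-b) := by
    rw [← Real.Gamma_add_one (neg_ne_zero.2 hb₀)]
    ring_nf
  have h := Real.integral_rpow_mul_exp_neg_mul_Ioi (a := 1 - b) (by linarith) hr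
  calc _ = ∫ x in Ioi (0 : ℝ), ((-(x ^ (1 - b - 1) * Real.exp (-(r * x))) : ℝ) : ℂ) := by
        refine setIntegral_congr_fun measurableSet_Ioi fun x (hx : 0 < x) => ?_
        rw [show 1 - b - 1 = -b by ring, ← mul_rpow_neg_one_sub hx]
        push_cast
        ring_nf
    _ = ((-((1 / r) ^ (1 - b) * Real.Gamma (1 - b)) : ℝ) : ℂ) := by
        rw [integral_complex_ofReal, integral_neg, h]
    _ = _ := by
        rw [hG, one_div, Real.inv_rpow hr.le, ← Real.rpow_neg hr.le,
          show -(1 - b) = b - 1 by ring]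
        push_cast [Complex.ofReal_cpow hr.le]
        ring

lemma integral_cexp_sub_mul_rpow {b : ℝ} {z : ℂ} {r : ℝ} (hb : b < 1) (hb₀ : b ≠ 0)
    (hz : 0 < z.re) (hr : 0 < r) :
    ∫ x in Ioi (0 : ℝ), (Complex.exp (-z * x) - Complex.exp (-(r : ℂ) * x)) *
      ((x ^ (-1 - b) : ℝ) : ℂ) =
      (Real.Gamma (-b) : ℂ) * (z ^ (b : ℂ) - (r : ℂ) ^ (b : ℂ)) := by
  let U : Set ℂ := {u | 0 < u.re}
  have hU : IsOpen U := isOpen_lt continuous_const Complex.continuous_re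
  have hUc : IsPreconnected U := (convex_halfSpace_re_gt 0).isPreconnected
  have hrU : (r : ℂ) ∈ U := by simpa [U] using hr
  let H : ℂ → ℂ := fun u => (∫ x in Ioi (0 : ℝ),
    (Complex.exp (-u * x) - Complex.exp (-(r : ℂ) * x)) * ((x ^ (-1 - b) : ℝ) : ℂ)) -
      (Real.Gamma (-b) : ℂ) * (u ^ (b : ℂ) - (r : ℂ) ^ (b : ℂ))
  have hH : ∀ u ∈ U, HasDerivAt H
      ((∫ x in Ioi (0 : ℝ), Complex.exp (-u * x) * (-1 * x) * ((x ^ (-1 - b) : ℝ) : ℂ)) -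
        (Real.Gamma (-b) : ℂ) * ((b : ℂ) * u ^ ((b : ℂ) - 1))) u := fun u hu =>
    (hasDerivAt_integral_cexp_sub_mul_rpow hb hu hrU).sub
      (((Complex.hasStrictDerivAt_cpow_const (Or.inl hu)).hasDerivAt.sub_const _).const_mul _)
  have hHd : DifferentiableOn ℂ H U := fun u hu =>
    (hH u hu).differentiableAt.differentiableWithinAt
  have hreal : ∀ s : ℝ, 0 < s → deriv H s = 0 := fun s hs => by
    rw [(hH s (by simpa [U] using hs)).deriv, integral_cexp_mul_rpow_of_pos hb hb₀ hs, sub_self]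
  have hfreq : ∃ᶠ u in nhdsWithin (r : ℂ) {(r : ℂ)}ᶜ, deriv H u = 0 := by
    have ht : Filter.Tendsto (fun s : ℝ => (s : ℂ)) (nhdsWithin r {r}ᶜ)
        (nhdsWithin (r : ℂ) {(r : ℂ)}ᶜ) :=
      Complex.continuous_ofReal.continuousWithinAt.tendsto_nhdsWithin fun s hs => by
        simpa using hs
    refine ht.frequently (Filter.Eventually.frequently ?_)
    filter_upwards [nhdsWithin_le_nhds (lt_mem_nhds hr)] with s hs using hreal s hs
  have hderiv : EqOn (deriv H) 0 U :=
    ((hHd.deriv hU).analyticOnNhd hU).eqOn_zero_of_preconnected_of_frequently_eq_zero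
      hUc hrU hfreq
  have hconst : H z = H r := hU.is_const_of_deriv_eq_zero hUc hHd hderiv hz hrU
  have hHr : H r = 0 := by simp [H]
  exact sub_eq_zero.1 (hconst.trans hHr)

/-- For all real numbers `λ > 0`, `β ∈ (0,1)` and `t ∈ ℝ`, the integral
`∫₀^∞ (e^{i·t·x} − 1)·x^{−1−β}·e^{−λ·x} dx` converges absolutely and equals
`Γ(−β)·((λ − i·t)^β − λ^β)`, with the complex power taken on the principal
branch of the complex logarithm. -/
theorem tempered_stable_characteristic_exponent_integral
    (lam beta t : ℝ) (hlam : 0 < lam) (hbeta : beta ∈ Set.Ioo (0 : ℝ) 1) :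
    IntegrableOn
      (fun x : ℝ =>
        (Complex.exp (Complex.I * t * x) - 1) *
          ((x ^ (-1 - beta) * Real.exp (-lam * x) : ℝ) : ℂ))
      (Set.Ioi 0) ∧
    ∫ x in Set.Ioi (0 : ℝ),
        (Complex.exp (Complex.I * t * x) - 1) *
          ((x ^ (-1 - beta) * Real.exp (-lam * x) : ℝ) : ℂ)
      = (Real.Gamma (-beta) : ℂ) *
          (((lam : ℂ) - Complex.I * t) ^ (beta : ℂ) - (lam : ℂ) ^ (beta : ℂ)) := by
  have hz : 0 < ((lam : ℂ) - Complex.I * t).re := by simpa using hlam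
  have heq : (fun x : ℝ => (Complex.exp (Complex.I * t * x) - 1) *
      ((x ^ (-1 - beta) * Real.exp (-lam * x) : ℝ) : ℂ)) =
      fun x : ℝ => (Complex.exp (-((lam : ℂ) - Complex.I * t) * x) -
        Complex.exp (-(lam : ℂ) * x)) * ((x ^ (-1 - beta) : ℝ) : ℂ) := by
    funext x
    rw [show -((lam : ℂ) - Complex.I * t) * x = Complex.I * t * x + -lam * x by ring,
      Complex.exp_add]
    push_cast
    ring
  rw [heq]
  exact ⟨integrableOn_cexp_sub_mul_rpow hbeta.2 hz (by simpa using hlam),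
    integral_cexp_sub_mul_rpow hbeta.2 hbeta.1.ne' hz hlam⟩
end

section
/- If λ⁺ ≥ 2, then Ψ(2) − 2·Ψ(1) > 0; in particular, the constant c = (Ψ(1) − (r−q))/(Ψ(2) − 2Ψ(1)) appearing in the Föllmer–Schweizer minimal martingale measure construction is well-defined. -/
open Set

lemma Real.Gamma_neg_of_mem_Ioo {b : ℝ} (hb : b ∈ Ioo (0 : ℝ) 1) : Real.Gamma (-b) < 0 := by
  have h := Real.Gamma_add_one (neg_ne_zero.mpr hb.1.ne')
  have hpos : 0 < Real.Gamma (-b + 1) := Real.Gamma_pos_of_pos (by linarith [hb.2])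
  rw [h] at hpos
  exact neg_of_mul_pos_right hpos (by linarith [hb.1])

lemma Real.rpow_add_rpow_add_two_lt {b x : ℝ} (hb : b ∈ Ioo (0 : ℝ) 1) (hx : 0 ≤ x) :
    x ^ b + (x + 2) ^ b < 2 * (x + 1) ^ b := by
  have h := (Real.strictConcaveOn_rpow hb.1 hb.2).2 (mem_Ici.mpr hx)
    (mem_Ici.mpr (by linarith : (0 : ℝ) ≤ x + 2)) (by linarith : x ≠ x + 2)
    (by norm_num : (0 : ℝ) < 1 / 2) (by norm_num : (0 : ℝ) < 1 / 2) (by norm_num)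
  simp only [smul_eq_mul] at h
  rw [show 1 / 2 * x + 1 / 2 * (x + 2) = x + 1 by ring] at h
  linarith

/-- If `λ⁺ ≥ 2`, then `Ψ(2) − 2·Ψ(1) > 0`, where `Ψ` is the cumulant generating
function of the tempered stable distribution `TS(α⁺,β⁺,λ⁺;α⁻,β⁻,λ⁻)`; in
particular the constant `c = (Ψ(1) − (r−q))/(Ψ(2) − 2Ψ(1))` of the
Föllmer–Schweizer minimal martingale measure construction is well-defined. -/
theorem tempered_stable_FS_denominator_pos
    (ap lp am lm bp bm : ℝ)
    (hap : 0 < ap) (hlp : 0 < lp) (ham : 0 < am) (hlm : 0 < lm)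
    (hbp : bp ∈ Set.Ioo (0 : ℝ) 1) (hbm : bm ∈ Set.Ioo (0 : ℝ) 1)
    (hlp2 : 2 ≤ lp)
    (Psi : ℝ → ℝ)
    (hPsi : ∀ z, Psi z =
      ap * Real.Gamma (-bp) * ((lp - z) ^ bp - lp ^ bp)
        + am * Real.Gamma (-bm) * ((lm + z) ^ bm - lm ^ bm)) :
    Psi 2 - 2 * Psi 1 > 0 := by
  have hp := Real.rpow_add_rpow_add_two_lt hbp (sub_nonneg.mpr hlp2)
  rw [sub_add_cancel, show lp - 2 + 1 = lp - 1 by ring] at hp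
  have hm := Real.rpow_add_rpow_add_two_lt hbm hlm.le
  have hp' := mul_pos_of_neg_of_neg
    (mul_neg_of_pos_of_neg hap (Real.Gamma_neg_of_mem_Ioo hbp)) (sub_neg.mpr hp)
  have hm' := mul_pos_of_neg_of_neg
    (mul_neg_of_pos_of_neg ham (Real.Gamma_neg_of_mem_Ioo hbm)) (sub_neg.mpr hm)
  rw [hPsi, hPsi]
  linarith
end

section
/- Assume λ⁺ + λ⁻ > 1. Then the function f is continuous and strictly increasing on the interval [−λ⁻, λ⁺−1]. -/
open Set

theorem StrictConcaveOn.add_sub_lt_add_sub {g : ℝ → ℝ} {s : Set ℝ}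
    (hg : StrictConcaveOn ℝ s g) {x y h : ℝ} (hx : x ∈ s) (hyh : y + h ∈ s)
    (hh : 0 < h) (hxy : x < y) : g (y + h) - g y < g (x + h) - g x := by
  have hL : 0 < y + h - x := by linarith
  have ha : 0 < (y - x) / (y + h - x) := div_pos (by linarith) hL
  have hb : 0 < h / (y + h - x) := div_pos hh hL
  have hab : (y - x) / (y + h - x) + h / (y + h - x) = 1 := by
    field_simp
    ring
  have hne : x ≠ y + h := by linarith
  have h₁ := hg.2 hx hyh hne ha hb hab
  have h₂ := hg.2 hx hyh hne hb ha (by rw [add_comm, hab])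
  simp only [smul_eq_mul] at h₁ h₂
  have e₁ : (y - x) / (y + h - x) * x + h / (y + h - x) * (y + h) = x + h := by
    field_simp
    ring
  have e₂ : h / (y + h - x) * x + (y - x) / (y + h - x) * (y + h) = y := by
    field_simp
    ring
  rw [e₁] at h₁
  rw [e₂] at h₂
  have hsum : g x + g (y + h) =
      ((y - x) / (y + h - x) + h / (y + h - x)) * (g x + g (y + h)) := by
    rw [hab, one_mul]
  linarith

theorem Real.Gamma_neg_lt_zero {b : ℝ} (hb : b ∈ Set.Ioo (0 : ℝ) 1) :
    Real.Gamma (-b) < 0 := by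
  have h := Real.Gamma_add_one (neg_ne_zero.mpr hb.1.ne')
  have hpos : 0 < Real.Gamma (-b + 1) := Real.Gamma_pos_of_pos (by linarith [hb.2])
  have hb₀ := hb.1
  by_contra! hle
  nlinarith [mul_nonneg hb₀.le hle]

/-- If `λ⁺ + λ⁻ > 1`, the function
`f(Θ) = α⁺Γ(−β⁺)[(λ⁺−Θ−1)^{β⁺} − (λ⁺−Θ)^{β⁺}] + α⁻Γ(−β⁻)[(λ⁻+Θ+1)^{β⁻} − (λ⁻+Θ)^{β⁻}]`
is continuous and strictly increasing on `[−λ⁻, λ⁺−1]`. -/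
theorem esscher_function_continuous_strictMono
    (ap lp am lm bp bm : ℝ)
    (hap : 0 < ap) (hlp : 0 < lp) (ham : 0 < am) (hlm : 0 < lm)
    (hbp : bp ∈ Set.Ioo (0 : ℝ) 1) (hbm : bm ∈ Set.Ioo (0 : ℝ) 1)
    (hsum : lp + lm > 1)
    (f : ℝ → ℝ)
    (hf : ∀ Θ, f Θ =
      ap * Real.Gamma (-bp) * ((lp - Θ - 1) ^ bp - (lp - Θ) ^ bp)
        + am * Real.Gamma (-bm) * ((lm + Θ + 1) ^ bm - (lm + Θ) ^ bm)) :
    ContinuousOn f (Set.Icc (-lm) (lp - 1)) ∧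
      StrictMonoOn f (Set.Icc (-lm) (lp - 1)) := by
  have hcp : ap * Real.Gamma (-bp) < 0 := mul_neg_of_pos_of_neg hap (Real.Gamma_neg_lt_zero hbp)
  have hcm : am * Real.Gamma (-bm) < 0 := mul_neg_of_pos_of_neg ham (Real.Gamma_neg_lt_zero hbm)
  have hpow : ∀ {b : ℝ}, 0 < b → Continuous fun x : ℝ => x ^ b := fun hb =>
    Real.continuous_rpow_const hb.le
  refine ⟨?_, ?_⟩
  · rw [funext hf]
    have h₁ := (hpow hbp.1).comp (by fun_prop : Continuous fun Θ : ℝ => lp - Θ - 1)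
    have h₂ := (hpow hbp.1).comp (by fun_prop : Continuous fun Θ : ℝ => lp - Θ)
    have h₃ := (hpow hbm.1).comp (by fun_prop : Continuous fun Θ : ℝ => lm + Θ + 1)
    have h₄ := (hpow hbm.1).comp (by fun_prop : Continuous fun Θ : ℝ => lm + Θ)
    exact ((continuous_const.mul (h₁.sub h₂)).add
      (continuous_const.mul (h₃.sub h₄))).continuousOn
  · intro x hx y hy hxy
    have hp := (Real.strictConcaveOn_rpow hbp.1 hbp.2).add_sub_lt_add_sub
      (x := lp - y - 1) (y := lp - x - 1) (h := 1)
      (Set.mem_Ici.mpr (by linarith [hy.2])) (Set.mem_Ici.mpr (by linarith [hx.2]))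
      one_pos (by linarith)
    have hm := (Real.strictConcaveOn_rpow hbm.1 hbm.2).add_sub_lt_add_sub
      (x := lm + x) (y := lm + y) (h := 1)
      (Set.mem_Ici.mpr (by linarith [hx.1])) (Set.mem_Ici.mpr (by linarith [hy.1]))
      one_pos (by linarith)
    simp only [sub_add_cancel] at hp
    rw [hf, hf]
    refine add_lt_add ?_ ?_
    · exact mul_lt_mul_of_neg_left (by linarith) hcp
    · exact mul_lt_mul_of_neg_left hm hcm
end

section
/- Assume λ⁺ + λ⁻ > 1 and fix real numbers r ≥ q ≥ 0. Then there exists Θ in the half-open interval (−λ⁻, λ⁺−1] with f(Θ) = r − q if and only if f(−λ⁻) < r − q ≤ f(λ⁺−1); moreover, in case of existence such Θ is unique. -/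
open Set

theorem Real.strictAntiOn_rpow_add_one_sub {b : ℝ} (hb : b ∈ Set.Ioo (0 : ℝ) 1) :
    StrictAntiOn (fun x : ℝ => (x + 1) ^ b - x ^ b) (Set.Ici 0) := by
  intro x hx y hy hxy
  rw [Set.mem_Ici] at hx hy
  have hd : 0 < y - x + 1 := by linarith
  have hs : 0 < 1 / (y - x + 1) := by positivity
  have ht : 0 < (y - x) / (y - x + 1) := div_pos (sub_pos.mpr hxy) hd
  have hst : 1 / (y - x + 1) + (y - x) / (y - x + 1) = 1 := by field_simp; ring
  have hne : x ≠ y + 1 := by linarith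
  have hy1 : y + 1 ∈ Set.Ici (0 : ℝ) := Set.mem_Ici.mpr (by linarith)
  have hconc := Real.strictConcaveOn_rpow hb.1 hb.2
  have h₁ := hconc.2 (Set.mem_Ici.mpr hx) hy1 hne ht hs (by linarith)
  have h₂ := hconc.2 (Set.mem_Ici.mpr hx) hy1 hne hs ht hst
  have e₁ : (y - x) / (y - x + 1) * x + 1 / (y - x + 1) * (y + 1) = x + 1 := by
    field_simp; ring
  have e₂ : 1 / (y - x + 1) * x + (y - x) / (y - x + 1) * (y + 1) = y := by
    field_simp; ring
  simp only [smul_eq_mul, e₁, e₂] at h₁ h₂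
  have e : (1 / (y - x + 1) + (y - x) / (y - x + 1)) * (x ^ b + (y + 1) ^ b)
      = x ^ b + (y + 1) ^ b := by rw [hst, one_mul]
  show (y + 1) ^ b - y ^ b < (x + 1) ^ b - x ^ b
  linarith

/-- Assume `λ⁺ + λ⁻ > 1` and `r ≥ q ≥ 0`. Then there exists `Θ ∈ (−λ⁻, λ⁺−1]`
with `f(Θ) = r − q` if and only if `f(−λ⁻) < r − q ≤ f(λ⁺−1)`; moreover, in
case of existence, such `Θ` is unique. -/
theorem esscher_martingale_measure_existence
    (ap lp am lm bp bm r q : ℝ)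
    (hap : 0 < ap) (hlp : 0 < lp) (ham : 0 < am) (hlm : 0 < lm)
    (hbp : bp ∈ Set.Ioo (0 : ℝ) 1) (hbm : bm ∈ Set.Ioo (0 : ℝ) 1)
    (hsum : lp + lm > 1) (hrq : r ≥ q) (hq : q ≥ 0)
    (f : ℝ → ℝ)
    (hf : ∀ Θ, f Θ =
      ap * Real.Gamma (-bp) * ((lp - Θ - 1) ^ bp - (lp - Θ) ^ bp)
        + am * Real.Gamma (-bm) * ((lm + Θ + 1) ^ bm - (lm + Θ) ^ bm)) :
    ((∃ Θ ∈ Set.Ioc (-lm) (lp - 1), f Θ = r - q) ↔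
        (f (-lm) < r - q ∧ r - q ≤ f (lp - 1))) ∧
      ∀ Θ₁ ∈ Set.Ioc (-lm) (lp - 1), ∀ Θ₂ ∈ Set.Ioc (-lm) (lp - 1),
        f Θ₁ = r - q → f Θ₂ = r - q → Θ₁ = Θ₂ := by
  have hmono : StrictMonoOn f (Set.Icc (-lm) (lp - 1)) := by
    intro x hx y hy hxy
    have h₁ := Real.strictAntiOn_rpow_add_one_sub hbp
      (Set.mem_Ici.mpr (by linarith [hy.2] : 0 ≤ lp - y - 1))
      (Set.mem_Ici.mpr (by linarith [hx.2] : 0 ≤ lp - x - 1)) (by linarith)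
    have h₂ := Real.strictAntiOn_rpow_add_one_sub hbm
      (Set.mem_Ici.mpr (by linarith [hx.1] : 0 ≤ lm + x))
      (Set.mem_Ici.mpr (by linarith [hy.1] : 0 ≤ lm + y)) (by linarith)
    simp only [sub_add_cancel] at h₁ h₂
    have c₁ := mul_neg_of_pos_of_neg hap (Real.Gamma_neg_lt_zero hbp)
    have c₂ := mul_neg_of_pos_of_neg ham (Real.Gamma_neg_lt_zero hbm)
    rw [hf x, hf y]
    refine add_lt_add (mul_lt_mul_of_neg_left ?_ c₁) (mul_lt_mul_of_neg_left h₂ c₂)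
    linarith
  have hcont : ContinuousOn f (Set.Icc (-lm) (lp - 1)) := by
    have hp := Real.continuous_rpow_const hbp.1.le
    have hm := Real.continuous_rpow_const hbm.1.le
    rw [funext hf]
    exact Continuous.continuousOn
      ((continuous_const.mul ((hp.comp (by fun_prop : Continuous fun Θ => lp - Θ - 1)).sub
        (hp.comp (by fun_prop : Continuous fun Θ => lp - Θ)))).add
      (continuous_const.mul ((hm.comp (by fun_prop : Continuous fun Θ => lm + Θ + 1)).sub
        (hm.comp (by fun_prop : Continuous fun Θ => lm + Θ)))))
  have hle : -lm ≤ lp - 1 := by linarith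
  refine ⟨⟨?_, ?_⟩, ?_⟩
  · rintro ⟨Θ, hΘ, h⟩
    rw [← h]
    exact ⟨hmono (Set.left_mem_Icc.mpr hle) (Set.Ioc_subset_Icc_self hΘ) hΘ.1,
      hmono.monotoneOn (Set.Ioc_subset_Icc_self hΘ) (Set.right_mem_Icc.mpr hle) hΘ.2⟩
  · intro h
    exact intermediate_value_Ioc hle hcont h
  · intro Θ₁ h₁ Θ₂ h₂ e₁ e₂
    exact hmono.injOn (Set.Ioc_subset_Icc_self h₁) (Set.Ioc_subset_Icc_self h₂) (e₁.trans e₂.symm)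
end

section
/- The function φ : ℂ → ℂ defined by φ(z) = exp( α⁺·Γ(−β⁺)·((λ⁺ − i·z)^{β⁺} − (λ⁺)^{β⁺}) + α⁻·Γ(−β⁻)·((λ⁻ + i·z)^{β⁻} − (λ⁻)^{β⁻}) ), where complex powers are taken with the principal branch of the complex logarithm, is complex differentiable (holomorphic) at every point of the open strip { z ∈ ℂ : −λ⁺ < Im z < λ⁻ }. -/
/-- The analytic extension
`φ(z) = exp(α⁺Γ(−β⁺)((λ⁺ − i·z)^{β⁺} − (λ⁺)^{β⁺}) + α⁻Γ(−β⁻)((λ⁻ + i·z)^{β⁻} − (λ⁻)^{β⁻}))`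
of the characteristic function of the tempered stable distribution
`TS(α⁺,β⁺,λ⁺;α⁻,β⁻,λ⁻)` (complex powers on the principal branch) is
holomorphic on the strip `{z ∈ ℂ : −λ⁺ < Im z < λ⁻}`. -/
theorem tempered_stable_char_function_holomorphic_on_strip
    (ap lp am lm bp bm : ℝ)
    (hap : 0 < ap) (hlp : 0 < lp) (ham : 0 < am) (hlm : 0 < lm)
    (hbp : bp ∈ Set.Ioo (0 : ℝ) 1) (hbm : bm ∈ Set.Ioo (0 : ℝ) 1)
    (z : ℂ) (hz1 : -lp < z.im) (hz2 : z.im < lm) :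
    DifferentiableAt ℂ
      (fun w : ℂ => Complex.exp (
        (ap : ℂ) * (Real.Gamma (-bp) : ℂ) *
            (((lp : ℂ) - Complex.I * w) ^ (bp : ℂ) - (lp : ℂ) ^ (bp : ℂ))
          + (am : ℂ) * (Real.Gamma (-bm) : ℂ) *
            (((lm : ℂ) + Complex.I * w) ^ (bm : ℂ) - (lm : ℂ) ^ (bm : ℂ))))
      z := by
  have hp : (lp : ℂ) - Complex.I * z ∈ Complex.slitPlane := by
    refine Or.inl ?_
    simp only [Complex.sub_re, Complex.ofReal_re, Complex.I_mul_re]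
    linarith
  have hm : (lm : ℂ) + Complex.I * z ∈ Complex.slitPlane := by
    refine Or.inl ?_
    simp only [Complex.add_re, Complex.ofReal_re, Complex.I_mul_re]
    linarith
  have hid : DifferentiableAt ℂ (fun w : ℂ => Complex.I * w) z :=
    differentiableAt_id.const_mul _
  have hpowp := (hid.const_sub (lp : ℂ)).cpow_const (c := (bp : ℂ)) hp
  have hpowm := (hid.const_add (lm : ℂ)).cpow_const (c := (bm : ℂ)) hm
  exact (((hpowp.sub_const _).const_mul _).add ((hpowm.sub_const _).const_mul _)).cexp
end
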